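/- Let J be a Cartwright-Sturmfels* ideal of S and let C be the ideal of S generated by the monomials x_{11}^{a_1}···x_{v1}^{a_v} over all a = (a_1,...,a_v) ∈ Z^v with J_a ≠ 0. Then C = gin_τ(J) for every term order τ, and C is the unique Borel fixed ideal of S with the same Z^v-graded Hilbert series as J. -/

import Mathlib

open MvPolynomial

noncomputable section

namespace CSPaper

/-- The set of variables of the standard `ℤ^v`-graded polynomial ring `S`:
the variable `x_{i j}` of the paper (with `1 ≤ i ≤ v`, `1 ≤ j ≤ n_i`) corresponds to
`⟨i-1, j-1⟩ : MVar v n` where `n (i-1) = n_i - 1`; thus row `i` has `n i + 1 > 0`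
variables and the first variable `x_{i 1}` of row `i` corresponds to `⟨i, 0⟩`. -/
abbrev MVar (v : ℕ) (n : Fin v → ℕ) : Type := Σ i : Fin v, Fin (n i + 1)

/-- The weight function giving the standard `ℤ^v`-grading: `deg (x_{i j}) = e_i ∈ ℤ^v`. -/
def wt (v : ℕ) (n : Fin v → ℕ) : MVar v n → (Fin v → ℕ) := fun p => Pi.single p.1 1

variable {K : Type} [Field K] {v : ℕ} {n : Fin v → ℕ}

/-- An ideal of `S` is `ℤ^v`-graded (multigraded) iff it contains every multihomogeneous
component of each of its elements. -/
def IsMultigraded (I : Ideal (MvPolynomial (MVar v n) K)) : Prop :=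
  ∀ f ∈ I, ∀ a : Fin v → ℕ, weightedHomogeneousComponent (wt v n) a f ∈ I

/-- The value of the `ℤ^v`-graded Hilbert function of the ideal `I` at `a ∈ ℕ^v`:
`dim_K I_a`. -/
def hilb (I : Ideal (MvPolynomial (MVar v n) K)) (a : Fin v → ℕ) : ℕ :=
  Module.finrank K
    ((Submodule.restrictScalars K I ⊓ weightedHomogeneousSubmodule K (wt v n) a :
      Submodule K (MvPolynomial (MVar v n) K)))

/-- Two ideals have the same `ℤ^v`-graded Hilbert series. -/
def sameHS (I J : Ideal (MvPolynomial (MVar v n) K)) : Prop :=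
  ∀ a : Fin v → ℕ, hilb I a = hilb J a

/-- The `ℤ^v`-graded `K`-algebra endomorphism of `S` determined by a `v`-tuple of square
matrices: `x_{i j} ↦ ∑_k (g i)_{k j} x_{i k}`.  For invertible `g i` these are exactly the
elements of `G = GL_{n_1}(K) × ⋯ × GL_{n_v}(K)` acting on `S`. -/
def gAct (g : ∀ i : Fin v, Matrix (Fin (n i + 1)) (Fin (n i + 1)) K) :
    MvPolynomial (MVar v n) K →ₐ[K] MvPolynomial (MVar v n) K :=
  aeval fun p : MVar v n => ∑ k : Fin (n p.1 + 1), C (g p.1 k p.2) * X ⟨p.1, k⟩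

/-- A property `P` of `v`-tuples of matrices holds generically (i.e. for a general
`g ∈ GL_{n_1}(K) × ⋯ × GL_{n_v}(K)`) if there is a nonzero polynomial `h` in the matrix
entries such that `P g` holds for every invertible `g` with `h(g) ≠ 0`. -/
def Generically
    (P : (∀ i : Fin v, Matrix (Fin (n i + 1)) (Fin (n i + 1)) K) → Prop) : Prop :=
  ∃ h : MvPolynomial (Σ i : Fin v, Fin (n i + 1) × Fin (n i + 1)) K, h ≠ 0 ∧
    ∀ g : ∀ i : Fin v, Matrix (Fin (n i + 1)) (Fin (n i + 1)) K,
      (∀ i, IsUnit (g i).det) →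
      eval (fun q : Σ i : Fin v, Fin (n i + 1) × Fin (n i + 1) => g q.1 q.2.1 q.2.2) h ≠ 0 →
      P g

/-- The leading exponent (exponent of the leading monomial) of a polynomial with respect to
a term order `τ` (a `MonomialOrder`); by convention `leadExp τ 0 = 0`. -/
def leadExp (τ : MonomialOrder (MVar v n)) (f : MvPolynomial (MVar v n) K) :
    MVar v n →₀ ℕ :=
  τ.toSyn.symm (f.support.sup τ.toSyn)

/-- The initial ideal `in_τ(I)`: the monomial ideal generated by the leading monomials of the
nonzero elements of `I`. -/
def inIdeal (τ : MonomialOrder (MVar v n)) (I : Ideal (MvPolynomial (MVar v n) K)) :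
    Ideal (MvPolynomial (MVar v n) K) :=
  Ideal.span {m | ∃ f ∈ I, f ≠ 0 ∧ m = monomial (leadExp τ f) (1 : K)}

/-- `G` is a Gröbner basis of `I` with respect to the term order `τ`. -/
def IsGroebnerBasis (τ : MonomialOrder (MVar v n)) (G : Set (MvPolynomial (MVar v n) K))
    (I : Ideal (MvPolynomial (MVar v n) K)) : Prop :=
  G ⊆ (I : Set (MvPolynomial (MVar v n) K)) ∧
    Ideal.span ((fun f => monomial (leadExp τ f) (1 : K)) '' {f ∈ G | f ≠ 0}) = inIdeal τ I

/-- `J = gin_τ(I)`, the `ℤ^v`-graded generic initial ideal: for a general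
`g ∈ GL_{n_1}(K) × ⋯ × GL_{n_v}(K)` one has `in_τ(g(I)) = J`. -/
def IsGin (τ : MonomialOrder (MVar v n)) (I J : Ideal (MvPolynomial (MVar v n) K)) : Prop :=
  Generically fun g => inIdeal τ (Ideal.map (gAct g) I) = J

/-- A term order such that `x_{i j} > x_{i k}` whenever `j < k`. -/
def RespectsVarOrder (τ : MonomialOrder (MVar v n)) : Prop :=
  ∀ (i : Fin v) (j k : Fin (n i + 1)), j < k →
    τ.toSyn (Finsupp.single (⟨i, k⟩ : MVar v n) 1) <
      τ.toSyn (Finsupp.single (⟨i, j⟩ : MVar v n) 1)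

/-- An ideal is Borel fixed if it is fixed by every element of the Borel subgroup
`B = B_{n_1}(K) × ⋯ × B_{n_v}(K)` of upper triangular invertible matrices (upper triangular
with respect to the order `x_{i 1} > x_{i 2} > ⋯` of the variables in each row). -/
def BorelFixed (I : Ideal (MvPolynomial (MVar v n) K)) : Prop :=
  ∀ g : ∀ i : Fin v, Matrix (Fin (n i + 1)) (Fin (n i + 1)) K,
    (∀ i, IsUnit (g i).det) →
    (∀ (i : Fin v) (k j : Fin (n i + 1)), j < k → g i k j = 0) →
    Ideal.map (gAct g) I = I

/-- A Cartwright-Sturmfels ideal: a `ℤ^v`-graded ideal with the same `ℤ^v`-graded Hilbert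
series as some radical Borel fixed ideal. -/
def IsCS (I : Ideal (MvPolynomial (MVar v n) K)) : Prop :=
  IsMultigraded I ∧ ∃ J : Ideal (MvPolynomial (MVar v n) K),
    J.IsRadical ∧ BorelFixed J ∧ sameHS I J

/-- The exponent of the monomial `x_{1 1}^{a 1} ⋯ x_{v 1}^{a v}` of
`T = K[x_{1 1}, …, x_{v 1}] ⊆ S`. -/
def Tmono (v : ℕ) (n : Fin v → ℕ) (a : Fin v → ℕ) : MVar v n →₀ ℕ :=
  ∑ i : Fin v, Finsupp.single (⟨i, 0⟩ : MVar v n) (a i)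

/-- A `ℤ^v`-graded ideal of `S` extended from `T`, i.e. generated by monomials in the
variables `x_{1 1}, …, x_{v 1}`. -/
def ExtendedFromT (J : Ideal (MvPolynomial (MVar v n) K)) : Prop :=
  ∃ A : Set (Fin v → ℕ),
    J = Ideal.span ((fun a => monomial (Tmono v n a) (1 : K)) '' A)

/-- A Cartwright-Sturmfels* ideal: a `ℤ^v`-graded ideal with the same `ℤ^v`-graded Hilbert
series as some ideal extended from `T`. -/
def IsCSstar (J : Ideal (MvPolynomial (MVar v n) K)) : Prop :=
  IsMultigraded J ∧ ∃ C : Ideal (MvPolynomial (MVar v n) K), ExtendedFromT C ∧ sameHS J C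

/-- A monomial ideal. -/
def IsMonomialIdeal (I : Ideal (MvPolynomial (MVar v n) K)) : Prop :=
  ∃ A : Set (MVar v n →₀ ℕ), I = Ideal.span ((fun s => monomial s (1 : K)) '' A)

/-- A squarefree monomial ideal. -/
def IsSqfreeMonomialIdeal (I : Ideal (MvPolynomial (MVar v n) K)) : Prop :=
  ∃ A : Set (MVar v n →₀ ℕ), (∀ s ∈ A, ∀ x, s x ≤ 1) ∧
    I = Ideal.span ((fun s => monomial s (1 : K)) '' A)

/-- `J` is the Alexander dual of the squarefree monomial ideal `I`: `J` is generated by the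
products `∏_{x ∈ P} x` as `P` ranges over the minimal primes of `I`. -/
def IsAlexanderDual (I J : Ideal (MvPolynomial (MVar v n) K)) : Prop :=
  J = Ideal.span {m | ∃ F : Finset (MVar v n),
    Ideal.span ((fun x => (X x : MvPolynomial (MVar v n) K)) '' ↑F) ∈ I.minimalPrimes ∧
    m = ∏ x ∈ F, X x}

/-- The sequence `x_{i j} - λ_{i j} x_{i 1}`, `1 ≤ i ≤ v`, `2 ≤ j ≤ n_i`, as a list. -/
def LamList (lam : MVar v n → K) : List (MvPolynomial (MVar v n) K) :=
  (List.finRange v).flatMap fun i =>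
    ((List.finRange (n i + 1)).drop 1).map fun j =>
      X (⟨i, j⟩ : MVar v n) - C (lam ⟨i, j⟩) * X (⟨i, 0⟩ : MVar v n)

/-- A property of the scalars `λ = (λ_{i j})` holds for general `λ ∈ K^N` if there is a
nonzero polynomial `h` in the `λ_{i j}` such that the property holds whenever `h(λ) ≠ 0`. -/
def GenericallyLam {v : ℕ} {n : Fin v → ℕ} (K : Type) [Field K]
    (P : (MVar v n → K) → Prop) : Prop :=
  ∃ h : MvPolynomial (MVar v n) K, h ≠ 0 ∧
    ∀ lam : MVar v n → K, eval lam h ≠ 0 → P lam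

variable {K : Type} [Field K] {v : ℕ} {n : Fin v → ℕ}

/-- A graded free resolution of an ideal `I` of a polynomial ring graded by an additive
monoid `M` via a weight function `w` on the variables:
`⋯ → F_2 → F_1 → F_0 → I → 0`, where `F_p` is the free module with (finite) basis `ι p`,
the basis element `i : ι p` having degree `deg p i ∈ M`, all maps are graded of degree `0`,
and the complex is exact. -/
structure GradedFreeResolution (σ : Type) (K : Type) [Field K] (M : Type) [AddCommMonoid M]
    (w : σ → M) (I : Ideal (MvPolynomial σ K)) where
  ι : ℕ → Type
  finite : ∀ p, Finite (ι p)
  deg : ∀ p, ι p → M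
  aug : (ι 0 →₀ MvPolynomial σ K) →ₗ[MvPolynomial σ K] MvPolynomial σ K
  d : ∀ p, (ι (p + 1) →₀ MvPolynomial σ K) →ₗ[MvPolynomial σ K] (ι p →₀ MvPolynomial σ K)
  aug_graded : ∀ i : ι 0, (aug (Finsupp.single i 1)).IsWeightedHomogeneous w (deg 0 i)
  d_graded : ∀ (p : ℕ) (i : ι (p + 1)) (j : ι p),
    (d p (Finsupp.single i 1)) j = 0 ∨
      ∃ b, ((d p (Finsupp.single i 1)) j).IsWeightedHomogeneous w b ∧
        b + deg p j = deg (p + 1) i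
  range_aug : LinearMap.range aug = (I : Submodule (MvPolynomial σ K) (MvPolynomial σ K))
  exact_zero : LinearMap.ker aug = LinearMap.range (d 0)
  exact : ∀ p, LinearMap.ker (d p) = LinearMap.range (d (p + 1))

/-- A graded free resolution is minimal if all entries of the matrices of the differentials
between free modules lie in the irrelevant maximal ideal, i.e. have zero constant term. -/
def GradedFreeResolution.Minimal {σ M : Type} [AddCommMonoid M] {w : σ → M}
    {I : Ideal (MvPolynomial σ K)} (F : GradedFreeResolution σ K M w I) : Prop :=
  ∀ (p : ℕ) (i : F.ι (p + 1)) (j : F.ι p),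
    MvPolynomial.constantCoeff ((F.d p (Finsupp.single i 1)) j) = 0

/-- The graded Betti number `β_{p,a}` read off from a (minimal) graded free resolution:
the number of basis elements of `F_p` of degree `a`. -/
def GradedFreeResolution.betti {σ M : Type} [AddCommMonoid M] {w : σ → M}
    {I : Ideal (MvPolynomial σ K)} (F : GradedFreeResolution σ K M w I) (p : ℕ) (a : M) :
    ℕ :=
  Nat.card {i : F.ι p // F.deg p i = a}

/-- The set of `t × t` minors of the matrix `A`. -/
def minorsSet {R : Type} [CommRing R] (t : ℕ) {m N : ℕ} (A : Matrix (Fin m) (Fin N) R) :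
    Set R :=
  {d | ∃ (r : Fin t → Fin m) (c : Fin t → Fin N),
    Function.Injective r ∧ Function.Injective c ∧ d = (A.submatrix r c).det}

/-- `I_t(A)`, the ideal generated by the `t × t` minors of `A`. -/
def minorsIdeal {R : Type} [CommRing R] (t : ℕ) {m N : ℕ}
    (A : Matrix (Fin m) (Fin N) R) : Ideal R :=
  Ideal.span (minorsSet t A)

/-- `A` is column-graded: `N ≤ v` and each entry of the `j`-th column is either `0` or
multihomogeneous of degree `e_j ∈ ℤ^v`. -/
def ColumnGraded {m N : ℕ} (A : Matrix (Fin m) (Fin N) (MvPolynomial (MVar v n) K)) :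
    Prop :=
  ∃ h : N ≤ v, ∀ i j, A i j = 0 ∨
    (A i j).IsWeightedHomogeneous (wt v n) (Pi.single (Fin.castLE h j) 1)

/-- `A` is row-graded: `m ≤ v` and each entry of the `i`-th row is either `0` or
multihomogeneous of degree `e_i ∈ ℤ^v`. -/
def RowGraded {m N : ℕ} (A : Matrix (Fin m) (Fin N) (MvPolynomial (MVar v n) K)) : Prop :=
  ∃ h : m ≤ v, ∀ i j, A i j = 0 ∨
    (A i j).IsWeightedHomogeneous (wt v n) (Pi.single (Fin.castLE h i) 1)

/-- The exponent of the polarization of the monomial `x_{1 1}^{a 1} ⋯ x_{v 1}^{a v}` of `T`: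
the squarefree monomial `∏_i x_{i 1} x_{i 2} ⋯ x_{i (a i)}`. -/
def polExp (v : ℕ) (n : Fin v → ℕ) (a : Fin v → ℕ) : MVar v n →₀ ℕ :=
  ∑ i : Fin v, ∑ j ∈ Finset.univ.filter (fun j : Fin (n i + 1) => (j : ℕ) < a i),
    Finsupp.single (⟨i, j⟩ : MVar v n) 1

/-- `P = pol(C)`, the polarization of an ideal `C` extended from `T`
(the exponents of the generators of `C` must fit inside `S`). -/
def IsPolarizationOfT (C P : Ideal (MvPolynomial (MVar v n) K)) : Prop :=
  ∃ A : Set (Fin v → ℕ), (∀ a ∈ A, ∀ i, a i ≤ n i + 1) ∧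
    C = Ideal.span ((fun a => monomial (Tmono v n a) (1 : K)) '' A) ∧
    P = Ideal.span ((fun a => monomial (polExp v n a) (1 : K)) '' A)

/-- `ψ` is an identification of the quotient of `S` by the `ℤ^v`-graded ideal `Q` with a
standard `ℤ^v`-graded polynomial ring, compatible with the gradings. -/
def IsGradedStructureIso {n₂ : Fin v → ℕ} (Q : Ideal (MvPolynomial (MVar v n) K))
    (ψ : (MvPolynomial (MVar v n) K ⧸ Q) ≃ₐ[K] MvPolynomial (MVar v n₂) K) : Prop :=
  ∀ (f : MvPolynomial (MVar v n) K) (a : Fin v → ℕ),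
    f.IsWeightedHomogeneous (wt v n) a →
      (ψ (Ideal.Quotient.mk Q f)).IsWeightedHomogeneous (wt v n₂) a

end CSPaper

open CSPaper

namespace CSPaper

section

variable {K : Type} [Field K] {v : ℕ} {n : Fin v → ℕ}

theorem weight_wt_apply (u : MVar v n →₀ ℕ) (i : Fin v) :
    Finsupp.weight (wt v n) u i = ∑ j : Fin (n i + 1), u ⟨i, j⟩ := by
  rw [Finsupp.weight_eq_sum, Finset.sum_apply, Fintype.sum_sigma, Finset.sum_eq_single i]
  · simp [wt]
  · intro k _ hk
    simp [wt, Pi.single_eq_of_ne hk.symm]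
  · simp

theorem Tmono_apply_zero (a : Fin v → ℕ) (i : Fin v) : Tmono v n a ⟨i, 0⟩ = a i := by
  simp only [Tmono, Finsupp.finsetSum_apply]
  rw [Finset.sum_eq_single i]
  · simp
  · intro k _ hk
    exact Finsupp.single_eq_of_ne (by simp [hk.symm])
  · simp

theorem Tmono_apply_of_ne_zero (a : Fin v → ℕ) (i : Fin v) {j : Fin (n i + 1)} (hj : j ≠ 0) :
    Tmono v n a ⟨i, j⟩ = 0 := by
  simp only [Tmono, Finsupp.finsetSum_apply]
  refine Finset.sum_eq_zero fun k _ => Finsupp.single_eq_of_ne ?_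
  rintro h
  obtain ⟨rfl, h⟩ := Sigma.mk.inj_iff.mp h
  exact hj (eq_of_heq h)

theorem weight_Tmono (a : Fin v → ℕ) : Finsupp.weight (wt v n) (Tmono v n a) = a := by
  ext i
  rw [weight_wt_apply, Finset.sum_eq_single 0, Tmono_apply_zero]
  · intro j _ hj
    exact Tmono_apply_of_ne_zero a i hj
  · simp

theorem Tmono_add (a b : Fin v → ℕ) : Tmono v n (a + b) = Tmono v n a + Tmono v n b := by
  simp [Tmono, Finset.sum_add_distrib]

theorem Tmono_mono {a b : Fin v → ℕ} (h : a ≤ b) : Tmono v n a ≤ Tmono v n b := by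
  obtain ⟨c, rfl⟩ := exists_add_of_le h
  rw [Tmono_add]
  exact le_self_add

theorem eq_Tmono_weight {u : MVar v n →₀ ℕ} (h : ∀ p : MVar v n, p.2 ≠ 0 → u p = 0) :
    u = Tmono v n (Finsupp.weight (wt v n) u) := by
  ext ⟨i, j⟩
  by_cases hj : j = 0
  · subst hj
    rw [Tmono_apply_zero, weight_wt_apply, Finset.sum_eq_single 0]
    · intro k _ hk
      exact h ⟨i, k⟩ hk
    · simp
  · rw [Tmono_apply_of_ne_zero _ _ hj, h ⟨i, j⟩ hj]

theorem le_Tmono_weight (τ : MonomialOrder (MVar v n)) (hτ : RespectsVarOrder τ)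
    (u : MVar v n →₀ ℕ) :
    τ.toSyn u ≤ τ.toSyn (Tmono v n (Finsupp.weight (wt v n) u)) := by
  induction u using Finsupp.induction_linear with
  | zero => simp [Tmono]
  | add f g hf hg =>
    rw [map_add, map_add, Tmono_add, map_add]
    exact add_le_add hf hg
  | single p k =>
    obtain ⟨i, j⟩ := p
    have h1 : Tmono v n (Finsupp.weight (wt v n) (Finsupp.single (⟨i, j⟩ : MVar v n) k)) =
        k • Finsupp.single (⟨i, 0⟩ : MVar v n) 1 := by
      rw [Finsupp.weight_single]
      ext ⟨i', j'⟩
      by_cases hj : j' = 0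
      · subst hj
        rw [Tmono_apply_zero]
        by_cases hi : i' = i
        · subst hi
          simp [wt]
        · rw [Finsupp.smul_apply, Finsupp.single_eq_of_ne (by simp [hi])]
          simp [wt, Pi.single_eq_of_ne hi]
      · rw [Tmono_apply_of_ne_zero _ _ hj, Finsupp.smul_apply, Finsupp.single_eq_of_ne, smul_zero]
        rintro h
        obtain ⟨rfl, h⟩ := Sigma.mk.inj_iff.mp h
        exact hj (eq_of_heq h)
    have h2 : Finsupp.single (⟨i, j⟩ : MVar v n) k = k • Finsupp.single (⟨i, j⟩ : MVar v n) 1 := by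
      simp
    rw [h1, h2, map_nsmul, map_nsmul]
    refine nsmul_le_nsmul_right ?_ k
    rcases (Fin.zero_le j).eq_or_lt with h | h
    · rw [← h]
    · exact (hτ i 0 j h).le

theorem finite_weight_eq (a : Fin v → ℕ) :
    {u : MVar v n →₀ ℕ | Finsupp.weight (wt v n) u = a}.Finite := by
  refine (Finsupp.finite_of_degree_le (∑ i, a i)).subset ?_
  rintro u rfl
  rw [Set.mem_ofPred_eq, Finsupp.degree_eq_sum, Fintype.sum_sigma]
  exact (Finset.sum_congr rfl fun i _ => (weight_wt_apply u i).symm).le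

instance finiteDimensional_weightedHomogeneousSubmodule (a : Fin v → ℕ) :
    FiniteDimensional K (weightedHomogeneousSubmodule K (wt v n) a) := by
  have hle : weightedHomogeneousSubmodule K (wt v n) a ≤
      Submodule.span K ((fun u => monomial u (1 : K)) ''
        {u : MVar v n →₀ ℕ | Finsupp.weight (wt v n) u = a}) := by
    intro f hf
    rw [f.as_sum]
    refine Submodule.sum_mem _ fun u hu => ?_
    rw [← mul_one (coeff u f), ← smul_eq_mul, ← smul_monomial]
    exact Submodule.smul_mem _ _ (Submodule.subset_span ⟨u, hf (mem_support_iff.mp hu), rfl⟩)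
  have := FiniteDimensional.span_of_finite K
    ((finite_weight_eq (v := v) (n := n) a).image fun u => monomial u (1 : K))
  exact Submodule.finiteDimensional_of_le hle

/-- The graded piece of degree `a` of the ideal `I`. -/
abbrev piece (I : Ideal (MvPolynomial (MVar v n) K)) (a : Fin v → ℕ) :
    Submodule K (MvPolynomial (MVar v n) K) :=
  Submodule.restrictScalars K I ⊓ weightedHomogeneousSubmodule K (wt v n) a

instance finiteDimensional_piece (I : Ideal (MvPolynomial (MVar v n) K)) (a : Fin v → ℕ) :
    FiniteDimensional K (piece I a) :=
  Submodule.finiteDimensional_of_le inf_le_right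

theorem hilb_ne_zero_iff {I : Ideal (MvPolynomial (MVar v n) K)} {a : Fin v → ℕ} :
    hilb I a ≠ 0 ↔ ∃ f ∈ I, f ≠ 0 ∧ f.IsWeightedHomogeneous (wt v n) a := by
  change Module.finrank K (piece I a) ≠ 0 ↔ _
  rw [ne_eq, Submodule.finrank_eq_zero, Submodule.eq_bot_iff]
  push Not
  constructor
  · rintro ⟨f, hf, h0⟩
    exact ⟨f, hf.1, h0, hf.2⟩
  · rintro ⟨f, hf, h0, hh⟩
    exact ⟨f, ⟨hf, hh⟩, h0⟩

theorem eq_of_le_of_hilb_le {I Q : Ideal (MvPolynomial (MVar v n) K)} (hIQ : I ≤ Q)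
    (hQ : IsMultigraded Q) (h : ∀ a, hilb Q a ≤ hilb I a) : Q = I := by
  refine le_antisymm (fun f hf => ?_) hIQ
  rw [← sum_weightedHomogeneousComponent (wt v n) f]
  refine finsum_induction (· ∈ I) I.zero_mem (fun _ _ => I.add_mem) fun a => ?_
  have heq : piece I a = piece Q a :=
    Submodule.eq_of_le_of_finrank_le (inf_le_inf_right _ hIQ) (h a)
  have hmem : weightedHomogeneousComponent (wt v n) a f ∈ piece Q a :=
    ⟨hQ f hf a, weightedHomogeneousComponent_isWeightedHomogeneous _ _⟩
  exact (heq ▸ hmem).1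

theorem isMultigraded_of_monomial_mem {Q : Ideal (MvPolynomial (MVar v n) K)}
    (hQ : ∀ f ∈ Q, ∀ u ∈ f.support, monomial u (1 : K) ∈ Q) : IsMultigraded Q := by
  classical
  intro f hf a
  rw [(weightedHomogeneousComponent (wt v n) a f).as_sum]
  refine Ideal.sum_mem _ fun u hu => ?_
  rw [mem_support_iff, coeff_weightedHomogeneousComponent] at hu
  rw [← mul_one (coeff u _), ← smul_eq_mul, ← smul_monomial, smul_eq_C_mul]
  exact Q.mul_mem_left _ (hQ f hf u (mem_support_iff.mpr (by aesop)))

theorem hilb_le_ncard_of_monomial_mem {Q : Ideal (MvPolynomial (MVar v n) K)}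
    (hQ : ∀ f ∈ Q, ∀ u ∈ f.support, monomial u (1 : K) ∈ Q) (a : Fin v → ℕ) :
    hilb Q a ≤ {u : MVar v n →₀ ℕ | Finsupp.weight (wt v n) u = a ∧
      monomial u (1 : K) ∈ Q}.ncard := by
  classical
  have hfin : {u : MVar v n →₀ ℕ | Finsupp.weight (wt v n) u = a ∧
      monomial u (1 : K) ∈ Q}.Finite := (finite_weight_eq a).subset fun _ h => h.1
  have hle : piece Q a ≤ Submodule.span K
      (hfin.toFinset.image fun u => monomial u (1 : K) : Finset (MvPolynomial (MVar v n) K)) := by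
    intro f hf
    rw [f.as_sum]
    refine Submodule.sum_mem _ fun u hu => ?_
    rw [← mul_one (coeff u f), ← smul_eq_mul, ← smul_monomial]
    refine Submodule.smul_mem _ _ (Submodule.subset_span ?_)
    rw [Finset.mem_coe]
    exact Finset.mem_image_of_mem _
      (hfin.mem_toFinset.mpr ⟨hf.2 (mem_support_iff.mp hu), hQ f hf.1 u hu⟩)
  rw [Set.ncard_eq_toFinset_card _ hfin]
  exact (Submodule.finrank_mono hle).trans
    ((finrank_span_finset_le_card _).trans Finset.card_image_le)

theorem monomial_mem_of_mem_span_monomial {A : Set (MVar v n →₀ ℕ)}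
    {f : MvPolynomial (MVar v n) K}
    (hf : f ∈ Ideal.span ((fun s => monomial s (1 : K)) '' A)) {u : MVar v n →₀ ℕ}
    (hu : u ∈ f.support) : monomial u (1 : K) ∈ Ideal.span ((fun s => monomial s (1 : K)) '' A) := by
  classical
  rw [mem_ideal_span_monomial_image] at hf ⊢
  intro w hw
  rw [Finset.mem_singleton.mp (support_monomial_subset hw)]
  exact hf u hu

theorem inIdeal_eq_span_image (τ : MonomialOrder (MVar v n))
    (I : Ideal (MvPolynomial (MVar v n) K)) :
    inIdeal τ I = Ideal.span ((fun s => monomial s (1 : K)) ''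
      {s | ∃ f ∈ I, f ≠ 0 ∧ leadExp τ f = s}) := by
  rw [inIdeal]
  congr 1
  ext m
  constructor
  · rintro ⟨f, hf, h0, rfl⟩
    exact ⟨_, ⟨f, hf, h0, rfl⟩, rfl⟩
  · rintro ⟨_, ⟨f, hf, h0, rfl⟩, rfl⟩
    exact ⟨f, hf, h0, rfl⟩

theorem exists_homogeneous_of_monomial_mem_inIdeal {τ : MonomialOrder (MVar v n)}
    {I : Ideal (MvPolynomial (MVar v n) K)} (hI : IsMultigraded I) {u : MVar v n →₀ ℕ}
    (hu : monomial u (1 : K) ∈ inIdeal τ I) :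
    ∃ f ∈ piece I (Finsupp.weight (wt v n) u), f ≠ 0 ∧ τ.degree f = u := by
  classical
  rw [inIdeal_eq_span_image, mem_ideal_span_monomial_image] at hu
  obtain ⟨_, ⟨f, hf, h0, rfl⟩, hle⟩ := hu u (by simp)
  obtain ⟨w, hw⟩ := exists_add_of_le hle
  have hm : monomial w (1 : K) ≠ 0 := by simp
  set q : MvPolynomial (MVar v n) K := f * monomial w 1 with hq
  have hq0 : q ≠ 0 := mul_ne_zero h0 hm
  have hqI : q ∈ I := I.mul_mem_right _ hf
  have hdeg : τ.degree q = u := by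
    rw [hq, τ.degree_mul h0 hm, hw, τ.degree_monomial]
    simp [leadExp, MonomialOrder.degree]
  set p := weightedHomogeneousComponent (wt v n) (Finsupp.weight (wt v n) u) q with hp
  have hcoeff : coeff u p ≠ 0 := by
    rw [hp, coeff_weightedHomogeneousComponent, if_pos rfl, ← hdeg]
    exact τ.coeff_degree_ne_zero_iff.mpr hq0
  refine ⟨p, ⟨hI q hqI _, weightedHomogeneousComponent_isWeightedHomogeneous _ _⟩, ?_, ?_⟩
  · intro h
    simp [h] at hcoeff
  · apply τ.toSyn.injective
    refine le_antisymm (τ.degree_le_iff.mpr fun w hw => ?_) (τ.le_degree (mem_support_iff.mpr hcoeff))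
    rw [mem_support_iff, hp, coeff_weightedHomogeneousComponent] at hw
    rw [← hdeg]
    exact τ.le_degree (mem_support_iff.mpr (by aesop))

theorem linearIndependent_of_injective_degree {ι σ R : Type*} [Field R] (τ : MonomialOrder σ)
    (f : ι → MvPolynomial σ R) (h0 : ∀ i, f i ≠ 0)
    (hinj : Function.Injective fun i => τ.degree (f i)) : LinearIndependent R f := by
  classical
  rw [linearIndependent_iff']
  intro s g hsum
  by_contra! hne
  obtain ⟨i, his, hi⟩ := hne
  obtain ⟨m, hm, hmax⟩ := (s.filter fun i => g i ≠ 0).exists_max_image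
    (fun i => τ.toSyn (τ.degree (f i))) ⟨i, by simp [his, hi]⟩
  rw [Finset.mem_filter] at hm
  have hc := congrArg (coeff (τ.degree (f m))) hsum
  rw [coeff_sum, Finset.sum_eq_single m, coeff_smul, coeff_zero, smul_eq_mul, mul_eq_zero] at hc
  · exact hc.elim hm.2 (τ.coeff_degree_ne_zero_iff.mpr (h0 m))
  · intro j hj hjm
    by_cases hgj : g j = 0
    · simp [hgj]
    · rw [coeff_smul, τ.coeff_eq_zero_of_lt, smul_zero]
      refine lt_of_le_of_ne (hmax j (by simp [hj, hgj])) fun h => hjm (hinj ?_)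
      exact τ.toSyn.injective h
  · intro h
    exact absurd hm.1 h

theorem ncard_le_hilb_of_inIdeal {τ : MonomialOrder (MVar v n)}
    {I : Ideal (MvPolynomial (MVar v n) K)} (hI : IsMultigraded I) (a : Fin v → ℕ) :
    {u : MVar v n →₀ ℕ | Finsupp.weight (wt v n) u = a ∧
      monomial u (1 : K) ∈ inIdeal τ I}.ncard ≤ hilb I a := by
  set E := {u : MVar v n →₀ ℕ | Finsupp.weight (wt v n) u = a ∧
      monomial u (1 : K) ∈ inIdeal τ I} with hE
  have hfin : E.Finite := (finite_weight_eq a).subset fun _ h => h.1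
  have hex : ∀ u : E, ∃ f ∈ piece I a, f ≠ 0 ∧ τ.degree f = u := by
    rintro ⟨u, rfl, hu⟩
    exact exists_homogeneous_of_monomial_mem_inIdeal hI hu
  choose F hF hF0 hFdeg using hex
  have hli : LinearIndependent K F := by
    refine linearIndependent_of_injective_degree τ F hF0 fun u w h => ?_
    simp only [hFdeg] at h
    exact Subtype.ext h
  have hli' : LinearIndependent K fun u : E => (⟨F u, hF u⟩ : piece I a) :=
    LinearIndependent.of_comp (piece I a).subtype hli
  have := hfin.fintype
  rw [← Nat.card_coe_set_eq, Nat.card_eq_fintype_card]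
  exact hli'.fintype_card_le_finrank

theorem hilb_inIdeal_le {τ : MonomialOrder (MVar v n)}
    {I : Ideal (MvPolynomial (MVar v n) K)} (hI : IsMultigraded I) (a : Fin v → ℕ) :
    hilb (inIdeal τ I) a ≤ hilb I a := by
  refine (hilb_le_ncard_of_monomial_mem ?_ a).trans (ncard_le_hilb_of_inIdeal hI a)
  rw [inIdeal_eq_span_image]
  exact fun f hf u hu => monomial_mem_of_mem_span_monomial hf hu

theorem isMultigraded_inIdeal (τ : MonomialOrder (MVar v n))
    (I : Ideal (MvPolynomial (MVar v n) K)) : IsMultigraded (inIdeal τ I) := by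
  refine isMultigraded_of_monomial_mem ?_
  rw [inIdeal_eq_span_image]
  exact fun f hf u hu => monomial_mem_of_mem_span_monomial hf hu

theorem gAct_X (g : ∀ i : Fin v, Matrix (Fin (n i + 1)) (Fin (n i + 1)) K) (p : MVar v n) :
    gAct g (X p) = ∑ k : Fin (n p.1 + 1), C (g p.1 k p.2) * X ⟨p.1, k⟩ := by
  simp [gAct]

theorem gAct_mul (g h : ∀ i : Fin v, Matrix (Fin (n i + 1)) (Fin (n i + 1)) K)
    (f : MvPolynomial (MVar v n) K) : gAct g (gAct h f) = gAct (g * h) f := by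
  change ((gAct g).comp (gAct h)) f = _
  congr 1
  refine algHom_ext fun p => ?_
  simp only [AlgHom.comp_apply, gAct_X, map_sum, map_mul, algHom_C, algebraMap_eq, Finset.mul_sum,
    Pi.mul_apply, Matrix.mul_apply, Finset.sum_mul]
  rw [Finset.sum_comm]
  exact Finset.sum_congr rfl fun k _ => Finset.sum_congr rfl fun l _ => by ring

theorem gAct_one (f : MvPolynomial (MVar v n) K) : gAct 1 f = f := by
  change gAct 1 f = AlgHom.id K _ f
  congr 1
  refine algHom_ext fun p => ?_
  rw [gAct_X, Finset.sum_eq_single p.2]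
  · simp
  · intro k _ hk
    simp [Matrix.one_apply_ne hk]
  · simp

theorem gAct_gAct_inv {g : ∀ i : Fin v, Matrix (Fin (n i + 1)) (Fin (n i + 1)) K}
    (hg : ∀ i, IsUnit (g i).det) (f : MvPolynomial (MVar v n) K) :
    gAct g (gAct (fun i => (g i)⁻¹) f) = f := by
  rw [gAct_mul]
  convert gAct_one f
  ext1 i
  exact Matrix.mul_nonsing_inv _ (hg i)

theorem gAct_inv_gAct {g : ∀ i : Fin v, Matrix (Fin (n i + 1)) (Fin (n i + 1)) K}
    (hg : ∀ i, IsUnit (g i).det) (f : MvPolynomial (MVar v n) K) :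
    gAct (fun i => (g i)⁻¹) (gAct g f) = f := by
  rw [gAct_mul]
  convert gAct_one f
  ext1 i
  exact Matrix.nonsing_inv_mul _ (hg i)

theorem isWeightedHomogeneous_gAct_X
    (g : ∀ i : Fin v, Matrix (Fin (n i + 1)) (Fin (n i + 1)) K) (p : MVar v n) :
    (gAct g (X p)).IsWeightedHomogeneous (wt v n) (wt v n p) := by
  rw [gAct_X]
  exact IsWeightedHomogeneous.sum _ _ _ fun k _ =>
    (isWeightedHomogeneous_X K (wt v n) ⟨p.1, k⟩).C_mul _

theorem isWeightedHomogeneous_gAct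
    (g : ∀ i : Fin v, Matrix (Fin (n i + 1)) (Fin (n i + 1)) K) {a : Fin v → ℕ}
    {f : MvPolynomial (MVar v n) K} (hf : f.IsWeightedHomogeneous (wt v n) a) :
    (gAct g f).IsWeightedHomogeneous (wt v n) a := by
  rw [f.as_sum, map_sum]
  refine IsWeightedHomogeneous.sum _ _ _ fun u hu => ?_
  rw [monomial_eq, map_mul, algHom_C, algebraMap_eq, Finsupp.prod, map_prod]
  refine IsWeightedHomogeneous.C_mul ?_ _
  rw [← hf (mem_support_iff.mp hu), Finsupp.weight_apply]
  refine IsWeightedHomogeneous.prod _ _ _ fun p _ => ?_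
  rw [map_pow]
  exact (isWeightedHomogeneous_gAct_X g p).pow _

theorem gAct_weightedHomogeneousComponent
    (g : ∀ i : Fin v, Matrix (Fin (n i + 1)) (Fin (n i + 1)) K) (a : Fin v → ℕ)
    (f : MvPolynomial (MVar v n) K) :
    weightedHomogeneousComponent (wt v n) a (gAct g f) =
      gAct g (weightedHomogeneousComponent (wt v n) a f) := by
  classical
  induction f using MvPolynomial.induction_on' with
  | monomial u c =>
    have h := isWeightedHomogeneous_monomial (wt v n) u c (rfl : Finsupp.weight (wt v n) u = _)
    rw [weightedHomogeneousComponent_of_mem (isWeightedHomogeneous_gAct g h),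
      weightedHomogeneousComponent_of_mem h]
    split_ifs <;> simp
  | add p q hp hq => simp only [map_add, hp, hq]

theorem mem_map_gAct {g : ∀ i : Fin v, Matrix (Fin (n i + 1)) (Fin (n i + 1)) K}
    (hg : ∀ i, IsUnit (g i).det) {I : Ideal (MvPolynomial (MVar v n) K)}
    {f : MvPolynomial (MVar v n) K} :
    f ∈ Ideal.map (gAct g) I ↔ ∃ q ∈ I, gAct g q = f :=
  Ideal.mem_map_iff_of_surjective (gAct g) fun f => ⟨_, gAct_gAct_inv hg f⟩

theorem isMultigraded_map_gAct {g : ∀ i : Fin v, Matrix (Fin (n i + 1)) (Fin (n i + 1)) K}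
    (hg : ∀ i, IsUnit (g i).det) {I : Ideal (MvPolynomial (MVar v n) K)}
    (hI : IsMultigraded I) : IsMultigraded (Ideal.map (gAct g) I) := by
  intro f hf a
  obtain ⟨q, hq, rfl⟩ := (mem_map_gAct hg).mp hf
  rw [gAct_weightedHomogeneousComponent]
  exact Ideal.mem_map_of_mem _ (hI q hq a)

theorem hilb_map_gAct_le {g : ∀ i : Fin v, Matrix (Fin (n i + 1)) (Fin (n i + 1)) K}
    (hg : ∀ i, IsUnit (g i).det) (I : Ideal (MvPolynomial (MVar v n) K)) (a : Fin v → ℕ) :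
    hilb (Ideal.map (gAct g) I) a ≤ hilb I a := by
  have hle : piece (Ideal.map (gAct g) I) a ≤ (piece I a).map (gAct g).toLinearMap := by
    rintro f ⟨hf, hfa⟩
    obtain ⟨q, hq, rfl⟩ := (mem_map_gAct hg).mp hf
    refine ⟨q, ⟨hq, ?_⟩, rfl⟩
    rw [← gAct_inv_gAct hg q]
    exact isWeightedHomogeneous_gAct _ hfa
  exact (Submodule.finrank_mono hle).trans (Submodule.finrank_map_le _ _)

theorem coeff_Tmono_eq_eval {a : Fin v → ℕ} {f : MvPolynomial (MVar v n) K}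
    (hf : f.IsWeightedHomogeneous (wt v n) a) :
    coeff (Tmono v n a) f = eval (fun p : MVar v n => if p.2 = 0 then 1 else 0) f := by
  rw [eval_eq, Finset.sum_eq_single (Tmono v n a)]
  · rw [Finset.prod_eq_one, mul_one]
    rintro ⟨i, j⟩ hp
    have hj : j = 0 := by
      by_contra hj
      exact Finsupp.mem_support_iff.mp hp (Tmono_apply_of_ne_zero a i hj)
    simp [hj]
  · intro u hu hne
    have hex : ∃ p : MVar v n, p.2 ≠ 0 ∧ u p ≠ 0 := by
      by_contra! h
      refine hne ?_
      rw [← hf (mem_support_iff.mp hu)]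
      exact eq_Tmono_weight h
    obtain ⟨p, hp, hup⟩ := hex
    rw [Finset.prod_eq_zero (Finsupp.mem_support_iff.mpr hup), mul_zero]
    rw [if_neg hp, zero_pow hup]
  · intro h
    rw [notMem_support_iff.mp h, zero_mul]

theorem coeff_Tmono_gAct (g : ∀ i : Fin v, Matrix (Fin (n i + 1)) (Fin (n i + 1)) K)
    {a : Fin v → ℕ} {f : MvPolynomial (MVar v n) K}
    (hf : f.IsWeightedHomogeneous (wt v n) a) :
    coeff (Tmono v n a) (gAct g f) = eval (fun p : MVar v n => g p.1 0 p.2) f := by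
  rw [coeff_Tmono_eq_eval (isWeightedHomogeneous_gAct g hf), gAct]
  change ((aeval (R := K) (S₁ := K) _).comp (aeval _)) f = aeval _ f
  congr 1
  refine algHom_ext fun p => ?_
  simp only [AlgHom.comp_apply, aeval_X, map_sum, map_mul, algHom_C, Algebra.algebraMap_self,
    RingHom.id_apply]
  rw [Finset.sum_eq_single 0]
  · simp
  · intro k _ hk
    rw [if_neg hk, mul_zero]
  · simp

theorem leadExp_eq_Tmono {τ : MonomialOrder (MVar v n)} (hτ : RespectsVarOrder τ)
    {a : Fin v → ℕ} {f : MvPolynomial (MVar v n) K}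
    (hf : f.IsWeightedHomogeneous (wt v n) a) (h : coeff (Tmono v n a) f ≠ 0) :
    leadExp τ f = Tmono v n a := by
  change τ.degree f = _
  apply τ.toSyn.injective
  refine le_antisymm (τ.degree_le_iff.mpr fun u hu => ?_) (τ.le_degree (mem_support_iff.mpr h))
  rw [← hf (mem_support_iff.mp hu)]
  exact le_Tmono_weight τ hτ u

theorem borelFixed_of_extendedFromT {I : Ideal (MvPolynomial (MVar v n) K)}
    (hI : ExtendedFromT I) : BorelFixed I := by
  obtain ⟨A, rfl⟩ := hI
  intro g hg htri
  have hdiag : ∀ i, g i 0 0 ≠ 0 := by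
    intro i h0
    refine (hg i).ne_zero (Matrix.det_eq_zero_of_column_eq_zero 0 fun k => ?_)
    rcases (Fin.zero_le k).eq_or_lt with h | h
    · rw [← h, h0]
    · exact htri i k 0 h
  have hact : ∀ a, gAct g (monomial (Tmono v n a) 1) =
      C (∏ i, g i 0 0 ^ a i) * monomial (Tmono v n a) 1 := by
    intro a
    have hX : ∀ i, gAct g (X ⟨i, 0⟩) = C (g i 0 0) * X ⟨i, 0⟩ := by
      intro i
      rw [gAct_X, Finset.sum_eq_single 0]
      · intro k _ hk
        simp [htri i k 0 (Fin.pos_of_ne_zero hk)]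
      · simp
    have hmon : monomial (Tmono v n a) (1 : K) = ∏ i, X (⟨i, 0⟩ : MVar v n) ^ a i := by
      simp [Tmono, X_pow_eq_monomial, monomial_sum_one]
    rw [hmon, map_prod, map_prod, ← Finset.prod_mul_distrib]
    exact Finset.prod_congr rfl fun i _ => by rw [map_pow, hX, mul_pow, map_pow]
  refine le_antisymm ?_ ?_
  · rw [Ideal.map_span, Ideal.span_le]
    rintro _ ⟨_, ⟨a, ha, rfl⟩, rfl⟩
    change gAct g (monomial (Tmono v n a) 1) ∈ _
    rw [hact]
    exact Ideal.mul_mem_left _ _ (Ideal.subset_span ⟨a, ha, rfl⟩)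
  · rw [Ideal.span_le]
    rintro _ ⟨a, ha, rfl⟩
    have hc : ∏ i, g i 0 0 ^ a i ≠ 0 := Finset.prod_ne_zero_iff.mpr fun i _ => pow_ne_zero _ (hdiag i)
    have hmem : gAct g (monomial (Tmono v n a) 1) ∈ Ideal.map (gAct g)
        (Ideal.span ((fun a => monomial (Tmono v n a) (1 : K)) '' A)) :=
      Ideal.mem_map_of_mem _ (Ideal.subset_span ⟨a, ha, rfl⟩)
    have := Ideal.mul_mem_left _ (C (∏ i, g i 0 0 ^ a i)⁻¹) hmem
    rwa [hact, ← mul_assoc, ← C_mul, inv_mul_cancel₀ hc, C_1, one_mul] at this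

theorem exists_eval_ne_zero_of_ne_zero {σ : Type*} [Fintype σ] [Infinite K]
    {f : MvPolynomial σ K} (hf : f ≠ 0) :
    ∃ t : σ → K, (∀ p, t p ≠ 0) ∧ eval t f ≠ 0 := by
  have hne : f * ∏ p, X p ≠ 0 :=
    mul_ne_zero hf (Finset.prod_ne_zero_iff.mpr fun p _ => X_ne_zero p)
  obtain ⟨t, ht⟩ : ∃ t, eval t (f * ∏ p, X p) ≠ 0 := by
    by_contra! h
    exact hne (MvPolynomial.funext fun t => by rw [h t, map_zero])
  rw [map_mul, map_prod, mul_ne_zero_iff, Finset.prod_ne_zero_iff] at ht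
  exact ⟨t, fun p => by simpa using ht.2 p (Finset.mem_univ _), ht.1⟩

theorem BorelFixed.monomial_mem [Infinite K] {I : Ideal (MvPolynomial (MVar v n) K)}
    (hI : BorelFixed I) : ∀ f ∈ I, ∀ u ∈ f.support, monomial u (1 : K) ∈ I := by
  intro f hf u hu
  by_contra hnot
  obtain ⟨φ, hφu, hφ⟩ := Submodule.exists_le_ker_of_notMem
    (p := Submodule.restrictScalars K I) (v := monomial u (1 : K)) hnot
  set P : MvPolynomial (MVar v n) K :=
    ∑ w ∈ f.support, monomial w (coeff w f * φ (monomial w 1)) with hP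
  have hcoeff : coeff u P = coeff u f * φ (monomial u 1) := by
    classical
    rw [hP, coeff_sum, Finset.sum_eq_single u]
    · simp
    · intro w _ hw
      rw [coeff_monomial, if_neg hw]
    · intro h
      exact absurd hu h
  have hP0 : P ≠ 0 := by
    intro h
    rw [h, coeff_zero, eq_comm, mul_eq_zero] at hcoeff
    exact hcoeff.elim (mem_support_iff.mp hu) hφu
  obtain ⟨t, ht, hPt⟩ := exists_eval_ne_zero_of_ne_zero hP0
  apply hPt
  let g : ∀ i : Fin v, Matrix (Fin (n i + 1)) (Fin (n i + 1)) K :=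
    fun i => Matrix.diagonal fun j => t ⟨i, j⟩
  have hgX : ∀ p, gAct g (X p) = C (t p) * X p := by
    intro p
    rw [gAct_X, Finset.sum_eq_single p.2]
    · simp [g]
    · intro k _ hk
      simp [g, Matrix.diagonal_apply_ne _ hk]
    · simp
  have hmap : Ideal.map (gAct g) I = I := by
    refine hI g (fun i => ?_) fun i k j hjk => Matrix.diagonal_apply_ne _ hjk.ne'
    rw [Matrix.det_diagonal, isUnit_iff_ne_zero, Finset.prod_ne_zero_iff]
    exact fun j _ => ht _
  have hgf : gAct g f ∈ I := hmap ▸ Ideal.mem_map_of_mem _ hf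
  have hφgf : φ (gAct g f) = 0 := hφ hgf
  have hgm : ∀ w c, gAct g (monomial w c) = (c * w.prod fun p k => t p ^ k) • monomial w 1 := by
    intro w c
    rw [monomial_eq, monomial_eq, map_mul, algHom_C, algebraMap_eq, smul_eq_C_mul, C_mul, C_1,
      one_mul, mul_assoc, Finsupp.prod, Finsupp.prod, map_prod, map_prod, ← Finset.prod_mul_distrib]
    simp only [map_pow, hgX, mul_pow]
  rw [← hφgf]
  conv_rhs => rw [f.as_sum]
  simp only [hP, map_sum, hgm, map_smul, smul_eq_mul, eval_monomial]
  exact Finset.sum_congr rfl fun w _ => by ring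

theorem BorelFixed.monomial_Tmono_mem [Infinite K] {I : Ideal (MvPolynomial (MVar v n) K)}
    (hI : BorelFixed I) {f : MvPolynomial (MVar v n) K} (hf : f ∈ I) (h0 : f ≠ 0)
    {a : Fin v → ℕ} (ha : f.IsWeightedHomogeneous (wt v n) a) :
    monomial (Tmono v n a) (1 : K) ∈ I := by
  obtain ⟨t, ht, hft⟩ := exists_eval_ne_zero_of_ne_zero h0
  let g : ∀ i : Fin v, Matrix (Fin (n i + 1)) (Fin (n i + 1)) K :=
    fun i => Matrix.of fun k j => if k = 0 then t ⟨i, j⟩ else if k = j then 1 else 0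
  have htri : ∀ (i : Fin v) (k j : Fin (n i + 1)), j < k → g i k j = 0 := by
    intro i k j hjk
    simp [g, hjk.ne', (Fin.zero_le j).trans_lt hjk |>.ne']
  have hmap : Ideal.map (gAct g) I = I := by
    refine hI g (fun i => ?_) htri
    rw [Matrix.det_of_isUpperTriangular fun k j hjk => htri i k j hjk, isUnit_iff_ne_zero,
      Finset.prod_ne_zero_iff]
    intro j _
    by_cases hj : j = 0
    · simp [g, hj, ht]
    · simp [g, hj]
  have hgf : gAct g f ∈ I := hmap ▸ Ideal.mem_map_of_mem _ hf
  refine hI.monomial_mem _ hgf _ (mem_support_iff.mpr ?_)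
  rw [coeff_Tmono_gAct g ha]
  simpa [g] using hft

theorem span_Tmono_eq_of_extendedFromT {J D : Ideal (MvPolynomial (MVar v n) K)}
    (hD : ExtendedFromT D) (hJD : sameHS J D) :
    Ideal.span {u : MvPolynomial (MVar v n) K | ∃ a : Fin v → ℕ,
      (∃ f ∈ J, f ≠ 0 ∧ f.IsWeightedHomogeneous (wt v n) a) ∧
      u = monomial (Tmono v n a) (1 : K)} = D := by
  simp only [← hilb_ne_zero_iff, hJD _]
  obtain ⟨A, rfl⟩ := hD
  refine le_antisymm (Ideal.span_le.mpr ?_) (Ideal.span_mono ?_)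
  · rintro _ ⟨a, ha, rfl⟩
    obtain ⟨f, hf, h0, hfa⟩ := hilb_ne_zero_iff.mp ha
    obtain ⟨u, hu⟩ := support_nonempty.mpr h0
    rw [← Set.image_image (fun s => monomial s (1 : K)) (Tmono v n),
      mem_ideal_span_monomial_image] at hf
    obtain ⟨_, ⟨b, hb, rfl⟩, hbu⟩ := hf u hu
    have hba : b ≤ a := by
      obtain ⟨w, rfl⟩ := exists_add_of_le hbu
      rw [← hfa (mem_support_iff.mp hu), map_add, weight_Tmono]
      exact le_self_add
    obtain ⟨c, rfl⟩ := exists_add_of_le hba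
    have hmul : monomial (Tmono v n (b + c)) (1 : K) =
        monomial (Tmono v n c) 1 * monomial (Tmono v n b) 1 := by
      rw [monomial_mul, Tmono_add, add_comm, one_mul]
    rw [hmul]
    exact Ideal.mul_mem_left _ _ (Ideal.subset_span ⟨b, hb, rfl⟩)
  · rintro _ ⟨a, ha, rfl⟩
    refine ⟨a, hilb_ne_zero_iff.mpr ⟨monomial (Tmono v n a) 1, ?_, by simp, ?_⟩, rfl⟩
    · exact Ideal.subset_span ⟨a, ha, rfl⟩
    · exact isWeightedHomogeneous_monomial _ _ _ (weight_Tmono a)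

theorem exists_generic_le_inIdeal_map {J D : Ideal (MvPolynomial (MVar v n) K)}
    (hD : D = Ideal.span {u : MvPolynomial (MVar v n) K | ∃ a : Fin v → ℕ,
      (∃ f ∈ J, f ≠ 0 ∧ f.IsWeightedHomogeneous (wt v n) a) ∧
      u = monomial (Tmono v n a) (1 : K)}) {τ : MonomialOrder (MVar v n)}
    (hτ : RespectsVarOrder τ) :
    Generically fun g => D ≤ inIdeal τ (Ideal.map (gAct g) J) := by
  classical
  obtain ⟨s, hs, hspan⟩ := (Submodule.fg_span_iff_fg_span_finset_subset _).mp
    ((isNoetherianRing_iff_ideal_fg _).mp inferInstance (Ideal.span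
      {u : MvPolynomial (MVar v n) K | ∃ a : Fin v → ℕ,
        (∃ f ∈ J, f ≠ 0 ∧ f.IsWeightedHomogeneous (wt v n) a) ∧
        u = monomial (Tmono v n a) (1 : K)}))
  have hex : ∀ u : s, ∃ (a : Fin v → ℕ) (f : MvPolynomial (MVar v n) K),
      (f ∈ J ∧ f ≠ 0 ∧ f.IsWeightedHomogeneous (wt v n) a) ∧
      (u : MvPolynomial (MVar v n) K) = monomial (Tmono v n a) (1 : K) := by
    rintro ⟨u, hu⟩
    obtain ⟨a, ⟨f, hf⟩, h⟩ := hs hu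
    exact ⟨a, f, hf, h⟩
  choose a f hf hu using hex
  let ρ : MVar v n → Σ i : Fin v, Fin (n i + 1) × Fin (n i + 1) := fun p => ⟨p.1, 0, p.2⟩
  have hρ : Function.Injective ρ := by
    rintro ⟨i, j⟩ ⟨i', j'⟩ h
    obtain ⟨rfl, h⟩ := Sigma.mk.inj_iff.mp h
    simpa using h
  refine ⟨∏ u : s, rename ρ (f u), Finset.prod_ne_zero_iff.mpr fun u _ =>
    (map_ne_zero_iff _ (rename_injective ρ hρ)).mpr (hf u).2.1, fun g _ hgen => ?_⟩
  rw [map_prod, Finset.prod_ne_zero_iff] at hgen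
  rw [hD]
  refine (le_of_eq hspan).trans (Ideal.span_le.mpr fun u hus => ?_)
  have hev := hgen ⟨u, hus⟩ (Finset.mem_univ _)
  rw [eval_rename] at hev
  have hhom := (hf ⟨u, hus⟩).2.2
  have hc : coeff (Tmono v n (a ⟨u, hus⟩)) (gAct g (f ⟨u, hus⟩)) ≠ 0 := by
    rw [coeff_Tmono_gAct g hhom]
    exact hev
  refine Ideal.subset_span ⟨gAct g (f ⟨u, hus⟩), Ideal.mem_map_of_mem _ (hf _).1, ?_, ?_⟩
  · intro h
    simp [h] at hc
  · rw [leadExp_eq_Tmono hτ (isWeightedHomogeneous_gAct g hhom) hc]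
    exact hu ⟨u, hus⟩

end

end CSPaper

/-- **Proposition (1) on CS* ideals.** Let `J` be a Cartwright-Sturmfels* ideal and let
`C = (x_{1 1}^{a 1} ⋯ x_{v 1}^{a v} : a ∈ ℤ^v, J_a ≠ 0)`.  Then `C = gin_τ(J)` for every
term order `τ`, and `C` is the unique Borel fixed ideal with the same `ℤ^v`-graded Hilbert
series as `J`. -/
theorem CSstar_gin_eq
    {K : Type} [Field K] [Infinite K] {v : ℕ} {n : Fin v → ℕ}
    (J : Ideal (MvPolynomial (MVar v n) K)) (hJ : IsCSstar J)
    (C : Ideal (MvPolynomial (MVar v n) K))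
    (hC : C = Ideal.span {u : MvPolynomial (MVar v n) K | ∃ a : Fin v → ℕ,
      (∃ f ∈ J, f ≠ 0 ∧ f.IsWeightedHomogeneous (wt v n) a) ∧
      u = monomial (Tmono v n a) (1 : K)}) :
    (∀ τ : MonomialOrder (MVar v n), RespectsVarOrder τ → IsGin τ J C) ∧
    BorelFixed C ∧ sameHS J C ∧
    ∀ C' : Ideal (MvPolynomial (MVar v n) K), BorelFixed C' → sameHS J C' → C' = C := by
  obtain ⟨hJgr, D, hD, hJD⟩ := hJ
  have hCD : C = D := hC.trans (span_Tmono_eq_of_extendedFromT hD hJD)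
  refine ⟨fun τ hτ => ?_, hCD ▸ borelFixed_of_extendedFromT hD, hCD ▸ hJD, fun C' hB hHS => ?_⟩
  · obtain ⟨h, h0, hle⟩ := exists_generic_le_inIdeal_map hC hτ
    refine ⟨h, h0, fun g hg hgen => ?_⟩
    refine eq_of_le_of_hilb_le (hle g hg hgen) (isMultigraded_inIdeal _ _) fun a => ?_
    calc hilb (inIdeal τ (Ideal.map (gAct g) J)) a
        ≤ hilb (Ideal.map (gAct g) J) a := hilb_inIdeal_le (isMultigraded_map_gAct hg hJgr) a
      _ ≤ hilb J a := hilb_map_gAct_le hg J a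
      _ = hilb C a := by rw [hCD, hJD a]
  · refine eq_of_le_of_hilb_le ?_ (isMultigraded_of_monomial_mem hB.monomial_mem) fun a => ?_
    · rw [hC, Ideal.span_le]
      rintro _ ⟨a, ha, rfl⟩
      rw [← hilb_ne_zero_iff, hHS a, hilb_ne_zero_iff] at ha
      obtain ⟨f, hf, h0, hfa⟩ := ha
      exact hB.monomial_Tmono_mem hf h0 hfa
    · rw [hCD, ← hHS a, hJD a]

end
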